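/- If X is a cyclic Veksler module over C(K) with cyclic vector x₀, then m(C(K)) is weak-operator closed in L(X); equivalently, when X is represented as a Banach lattice with quasi-interior point x₀, the center Z(X) equals m(C(K)). -/

import Mathlib

open Filter Topology

/-- `e` is the carrier projection of `x`: an idempotent in `C(K)` with `m e x = x`,
minimal among all idempotents `f` with `m f x = x`. -/
def IsCarrier {K X : Type*} [TopologicalSpace K] [CompactSpace K] [T2Space K]
    [NormedAddCommGroup X] [NormedSpace ℝ X] [CompleteSpace X]
    (m : C(K, ℝ) →ₐ[ℝ] (X →L[ℝ] X)) (x : X) (e : C(K, ℝ)) : Prop :=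
  e * e = e ∧ m e x = x ∧ ∀ f : C(K, ℝ), f * f = f → m f x = x → e ≤ f

section ClopenIndicator

variable {K : Type*} [TopologicalSpace K]

/-- The indicator function of a clopen set, as a continuous function. -/
noncomputable def clopenIndicator (s : Set K) (hs : IsClopen s) : C(K, ℝ) :=
  ⟨s.indicator 1, continuous_const.indicator (by simp [hs.frontier_eq])⟩

lemma clopenIndicator_of_mem {s : Set K} (hs : IsClopen s) {x : K} (hx : x ∈ s) :
    clopenIndicator s hs x = 1 := by
  simp [clopenIndicator, hx]

lemma clopenIndicator_of_notMem {s : Set K} (hs : IsClopen s) {x : K} (hx : x ∉ s) :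
    clopenIndicator s hs x = 0 := by
  simp [clopenIndicator, hx]

lemma clopenIndicator_mul_self {s : Set K} (hs : IsClopen s) :
    clopenIndicator s hs * clopenIndicator s hs = clopenIndicator s hs := by
  ext x
  by_cases hx : x ∈ s <;> simp [clopenIndicator, hx]

lemma clopenIndicator_mul_of_subset {s t : Set K} (hs : IsClopen s) (ht : IsClopen t)
    (h : s ⊆ t) : clopenIndicator s hs * clopenIndicator t ht = clopenIndicator s hs := by
  ext x
  by_cases hx : x ∈ s
  · simp [clopenIndicator, hx, h hx]
  · simp [clopenIndicator, hx]

lemma clopenIndicator_add_compl {s : Set K} (hs : IsClopen s) :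
    clopenIndicator s hs + clopenIndicator sᶜ hs.compl = 1 := by
  ext x
  by_cases hx : x ∈ s <;> simp [clopenIndicator, hx]

lemma norm_clopenIndicator_le [CompactSpace K] {s : Set K} (hs : IsClopen s) :
    ‖clopenIndicator s hs‖ ≤ 1 := by
  rw [ContinuousMap.norm_le _ zero_le_one]
  intro x
  by_cases hx : x ∈ s <;> simp [clopenIndicator, hx]

lemma idempotent_apply_eq_zero_or_one {e : C(K, ℝ)} (he : e * e = e) (x : K) :
    e x = 0 ∨ e x = 1 := by
  have h : e x * e x = e x := congrArg (fun f : C(K, ℝ) => f x) he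
  rcases eq_or_ne (e x) 0 with h0 | h0
  · exact Or.inl h0
  · exact Or.inr (mul_right_cancel₀ h0 (by rw [h, one_mul]))

lemma isClopen_support_of_idempotent {e : C(K, ℝ)} (he : e * e = e) :
    IsClopen {x | e x ≠ 0} := by
  refine ⟨?_, isOpen_ne_fun e.continuous continuous_const⟩
  have : {x | e x ≠ 0} = {x | e x = 1} := by
    ext x
    rcases idempotent_apply_eq_zero_or_one he x with h | h <;> simp [h]
  rw [this]
  exact isClosed_eq e.continuous continuous_const

/-- In a space where closures of cozero sets are open, the closure of a countable union of
cozero sets is open. -/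
lemma isOpen_closure_iUnion_cozero [CompactSpace K]
    (hBD : ∀ a : C(K, ℝ), IsOpen (closure {x | a x ≠ 0})) (g : ℕ → C(K, ℝ)) :
    IsOpen (closure (⋃ n, {x | g n x ≠ 0})) := by
  have hbound : ∀ n x, ‖(1 / 2 : ℝ) ^ n * min |g n x| 1‖ ≤ (1 / 2 : ℝ) ^ n := by
    intro n x
    rw [norm_mul, Real.norm_of_nonneg (by positivity : (0 : ℝ) ≤ (1 / 2 : ℝ) ^ n),
      Real.norm_of_nonneg (by positivity : (0 : ℝ) ≤ min |g n x| 1)]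
    exact mul_le_of_le_one_right (by positivity) (min_le_right _ _)
  have hcont : Continuous fun x => ∑' n, (1 / 2 : ℝ) ^ n * min |g n x| 1 :=
    continuous_tsum (fun n => by fun_prop) summable_geometric_two hbound
  have hsupp : {x | (⟨_, hcont⟩ : C(K, ℝ)) x ≠ 0} = ⋃ n, {x | g n x ≠ 0} := by
    ext x
    have hsum : Summable fun n => (1 / 2 : ℝ) ^ n * min |g n x| 1 :=
      Summable.of_norm_bounded summable_geometric_two fun n => hbound n x
    have hnonneg : ∀ n, 0 ≤ (1 / 2 : ℝ) ^ n * min |g n x| 1 := fun n => by positivity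
    have hiff := hsum.hasSum_iff.symm.trans (hasSum_zero_iff_of_nonneg hnonneg)
    rw [funext_iff] at hiff
    simp only [ContinuousMap.coe_mk, Set.mem_ofPred_eq, Set.mem_iUnion, ne_eq]
    rw [hiff, not_forall]
    refine exists_congr fun n => not_congr ?_
    constructor
    · intro h
      by_contra h0
      have : 0 < min |g n x| 1 := lt_min (abs_pos.2 h0) one_pos
      have : 0 < (1 / 2 : ℝ) ^ n * min |g n x| 1 := by positivity
      exact this.ne' h
    · intro h
      simp [h]
  rw [← hsupp]
  exact hBD _

/-- In a space where closures of cozero sets are open, bounded compatible functions on a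
sequence of clopen sets with dense union extend continuously to the whole space. -/
lemma exists_extension_of_compatible [CompactSpace K]
    (hBD : ∀ a : C(K, ℝ), IsOpen (closure {x | a x ≠ 0}))
    (D : ℕ → Set K) (hD : ∀ n, IsClopen (D n))
    (hdense : Dense (⋃ n, D n)) (b : ℕ → C(K, ℝ)) (M : ℝ) (hM : ∀ n, ‖b n‖ ≤ M)
    (hb : ∀ n l, n ≤ l → ∀ x ∈ D n, b l x = b n x) :
    ∃ f : C(K, ℝ), ∀ n, ∀ x ∈ D n, f x = b n x := by
  set f : K → ℝ := fun x => b (sInf {n | x ∈ D n}) x with hf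
  set U : Set K := ⋃ n, D n with hU
  have hfD : ∀ n, ∀ x ∈ D n, f x = b n x := by
    intro n x hx
    exact (hb _ _ (Nat.sInf_le hx) x (Nat.sInf_mem (s := {n | x ∈ D n}) ⟨n, hx⟩)).symm
  have hfM : ∀ x, |f x| ≤ M := fun x => ((b _).norm_coe_le_norm x).trans (hM _)
  have hUo : IsOpen U := isOpen_iUnion fun n => (hD n).isOpen
  have hfc : ContinuousOn f U := by
    intro x hx
    obtain ⟨n, hn⟩ := Set.mem_iUnion.1 hx
    refine ContinuousAt.continuousWithinAt ?_
    refine (b n).continuous.continuousAt.congr ?_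
    filter_upwards [(hD n).isOpen.mem_nhds hn] with t ht using (hfD n t ht).symm
  have hlim : ∀ x, ∃ y, Tendsto f (𝓝[U] x) (𝓝 y) := by
    intro x
    have : (𝓝[U] x).NeBot := mem_closure_iff_nhdsWithin_neBot.1 (hdense x)
    refine tendsto_of_no_upcrossings dense_univ ?_
      (isBoundedUnder_of ⟨M, fun t => (abs_le.1 (hfM t)).2⟩)
      (isBoundedUnder_of ⟨-M, fun t => (abs_le.1 (hfM t)).1⟩)
    rintro c - d - hcd ⟨hc, hd⟩
    set g : ℕ → C(K, ℝ) := fun n =>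
      clopenIndicator (D n) (hD n) * ⟨fun t => max (c - b n t) 0, by fun_prop⟩ with hg
    have hA : (⋃ n, {t | g n t ≠ 0}) = {t | t ∈ U ∧ f t < c} := by
      ext t
      simp only [Set.mem_iUnion, Set.mem_ofPred_eq, hU]
      constructor
      · rintro ⟨n, hn⟩
        have htD : t ∈ D n := by
          by_contra h
          exact hn (by simp [hg, clopenIndicator_of_notMem _ h])
        refine ⟨⟨n, htD⟩, ?_⟩
        rw [hfD n t htD]
        by_contra! h
        exact hn (by simp [hg, h])
      · rintro ⟨⟨n, htD⟩, h⟩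
        rw [hfD n t htD] at h
        refine ⟨n, ?_⟩
        have : 0 < c - b n t := sub_pos.2 h
        simp [hg, clopenIndicator_of_mem _ htD, max_eq_left this.le, this.ne']
    have hAo := isOpen_closure_iUnion_cozero hBD g
    rw [hA] at hAo
    have hxA : x ∈ closure {t | t ∈ U ∧ f t < c} := by
      rw [mem_closure_iff_frequently]
      exact (frequently_nhdsWithin_iff.1 hc).mono fun t ht => ⟨ht.2, ht.1⟩
    obtain ⟨t, ⟨htd, htU⟩, htA⟩ :=
      ((frequently_nhdsWithin_iff.1 hd).and_eventually (hAo.mem_nhds hxA)).exists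
    have hB : U ∩ f ⁻¹' Set.Ioi d ∈ 𝓝 t :=
      (hfc.isOpen_inter_preimage hUo isOpen_Ioi).mem_nhds ⟨htU, htd⟩
    obtain ⟨r, hr1, hr2⟩ := mem_closure_iff_nhds.1 htA _ hB
    exact absurd (hr1.2.out.trans hr2.2) (not_lt.2 hcd.le)
  refine ⟨⟨extendFrom U f, continuous_extendFrom hdense hlim⟩, fun n x hx => ?_⟩
  have hxU : x ∈ U := Set.mem_iUnion.2 ⟨n, hx⟩
  rw [← hfD n x hx]
  exact extendFrom_eq (hdense x) (hfc x hxU)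

end ClopenIndicator

section CyclicModule

variable {K X : Type*} [TopologicalSpace K]
  [NormedAddCommGroup X] [NormedSpace ℝ X] {m : C(K, ℝ) →ₐ[ℝ] (X →L[ℝ] X)}

lemma module_mul_apply (a b : C(K, ℝ)) (x : X) : m (a * b) x = m a (m b x) := by
  rw [map_mul]; rfl

lemma module_comm_apply (a b : C(K, ℝ)) (x : X) : m a (m b x) = m b (m a x) := by
  rw [← module_mul_apply, mul_comm, module_mul_apply]

/-- An operator commuting with the module action is determined by its value at a cyclic vector. -/
lemma eq_module_of_apply_cyclic {x₀ : X} (hcyc : DenseRange fun a : C(K, ℝ) => m a x₀)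
    {T : X →L[ℝ] X} (hT : ∀ a x, T (m a x) = m a (T x)) {b : C(K, ℝ)}
    (h : T x₀ = m b x₀) : T = m b := by
  refine ContinuousLinearMap.ext fun x => ?_
  refine congrFun (hcyc.equalizer T.continuous (m b).continuous (funext fun a => ?_)) x
  simp only [Function.comp_apply]
  rw [hT, h, module_comm_apply]

/-- An operator in the weak-operator closure of the module action commutes with it. -/
lemma commute_of_weak_limit {T : X →L[ℝ] X}
    (hT : ∀ ε > (0 : ℝ), ∀ s : Finset (X × (X →L[ℝ] ℝ)), ∃ a : C(K, ℝ),
        ∀ p ∈ s, |p.2 (m a p.1) - p.2 (T p.1)| < ε) (c : C(K, ℝ)) (x : X) :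
    T (m c x) = m c (T x) := by
  classical
  rw [SeparatingDual.eq_iff_forall_dual_eq (R := ℝ)]
  intro φ
  refine eq_of_forall_dist_le fun ε hε => ?_
  obtain ⟨a, ha⟩ := hT (ε / 2) (half_pos hε) {(m c x, φ), (x, φ.comp (m c))}
  have h1 := ha (m c x, φ) (by simp)
  have h2 := ha (x, φ.comp (m c)) (by simp)
  simp only [ContinuousLinearMap.comp_apply] at h1 h2
  rw [module_comm_apply c a x] at h2
  rw [abs_lt] at h1 h2
  rw [Real.dist_eq, abs_le]
  constructor <;> linarith

variable [CompactSpace K]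

lemma norm_module_apply_le (hm : ∀ a : C(K, ℝ), ‖m a‖ = ‖a‖) (a : C(K, ℝ)) (x : X) :
    ‖m a x‖ ≤ ‖a‖ * ‖x‖ :=
  hm a ▸ (m a).le_opNorm x

lemma norm_clopenIndicator_apply_le (hm : ∀ a : C(K, ℝ), ‖m a‖ = ‖a‖) {s : Set K}
    (hs : IsClopen s) (x : X) : ‖m (clopenIndicator s hs) x‖ ≤ ‖x‖ :=
  (norm_module_apply_le hm _ x).trans
    (mul_le_of_le_one_left (norm_nonneg _) (norm_clopenIndicator_le hs))

/-- A bound from below on a clopen set controls the clopen indicator. -/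
lemma norm_clopenIndicator_apply_le_of_le_abs (hm : ∀ a : C(K, ℝ), ‖m a‖ = ‖a‖) {s : Set K}
    (hs : IsClopen s) {h : C(K, ℝ)} {r : ℝ} (hr : 0 < r) (hh : ∀ t ∈ s, r ≤ |h t|) (x : X) :
    ‖m (clopenIndicator s hs) x‖ ≤ r⁻¹ * ‖m h x‖ := by
  have hpos : ∀ t, 0 < max |h t| r := fun t => lt_max_of_lt_right hr
  let c : C(K, ℝ) := clopenIndicator s hs *
    ⟨fun t => h t / (max |h t| r) ^ 2,
      h.continuous.div (by fun_prop) fun t => (pow_pos (hpos t) 2).ne'⟩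
  have hc : c * h = clopenIndicator s hs := by
    ext t
    by_cases ht : t ∈ s
    · have h1 := hh t ht
      have h0 : h t ≠ 0 := abs_pos.1 (hr.trans_le h1)
      simp only [c, ContinuousMap.mul_apply, clopenIndicator_of_mem hs ht,
        ContinuousMap.coe_mk, max_eq_left h1, sq_abs]
      field_simp
    · simp [c, clopenIndicator_of_notMem hs ht]
  have hcn : ‖c‖ ≤ r⁻¹ := by
    rw [ContinuousMap.norm_le _ (inv_nonneg.2 hr.le)]
    intro t
    have hbound : ‖h t / (max |h t| r) ^ 2‖ ≤ r⁻¹ := by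
      rw [norm_div, Real.norm_eq_abs, Real.norm_of_nonneg (by positivity), inv_eq_one_div,
        div_le_div_iff₀ (pow_pos (hpos t) 2) hr, one_mul, sq]
      exact mul_le_mul (le_max_left _ _) (le_max_right _ _) hr.le (hpos t).le
    by_cases ht : t ∈ s
    · simpa [c, clopenIndicator_of_mem hs ht] using hbound
    · simpa [c, clopenIndicator_of_notMem hs ht] using hr.le
  rw [← hc, module_mul_apply]
  exact (norm_module_apply_le hm _ _).trans (mul_le_mul_of_nonneg_right hcn (norm_nonneg _))

lemma module_injective (hm : ∀ a : C(K, ℝ), ‖m a‖ = ‖a‖) : Function.Injective m := by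
  intro a b h
  rw [← sub_eq_zero, ← norm_eq_zero, ← hm, map_sub, h, sub_self, norm_zero]

lemma eq_of_apply_cyclic (hm : ∀ a : C(K, ℝ), ‖m a‖ = ‖a‖) {x₀ : X}
    (hcyc : DenseRange fun a : C(K, ℝ) => m a x₀) {a b : C(K, ℝ)}
    (h : m a x₀ = m b x₀) : a = b :=
  module_injective hm (eq_module_of_apply_cyclic hcyc (fun _ _ => module_comm_apply _ _ _) h)

variable [T2Space K]

/-- Over a cyclic Veksler module, the closure of every cozero set of `K` is open. -/
lemma isOpen_closure_cozero [TotallyDisconnectedSpace K] [CompleteSpace X]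
    (hm : ∀ a : C(K, ℝ), ‖m a‖ = ‖a‖) {x₀ : X}
    (hcyc : DenseRange fun a : C(K, ℝ) => m a x₀)
    (hVeksler : ∀ z : X, z ≠ 0 → ∃ e : C(K, ℝ), IsCarrier m z e) (a : C(K, ℝ)) :
    IsOpen (closure {x | a x ≠ 0}) := by
  rcases eq_or_ne a 0 with rfl | ha
  · simp
  have hz : m a x₀ ≠ 0 := fun h =>
    ha (eq_of_apply_cyclic hm hcyc (by rw [h, map_zero, zero_apply]))
  obtain ⟨e, he, hez, hmin⟩ := hVeksler _ hz
  have hea : e * a = a := eq_of_apply_cyclic hm hcyc (by rw [module_mul_apply, hez])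
  have hclopen := isClopen_support_of_idempotent he
  have : closure {x | a x ≠ 0} = {x | e x ≠ 0} := by
    refine Set.Subset.antisymm (closure_minimal ?_ hclopen.isClosed) ?_
    · intro x hx hex
      exact hx (by rw [← hea, ContinuousMap.mul_apply, hex, zero_mul])
    · intro x hx
      by_contra hxa
      obtain ⟨V, hV, hxV, hVa⟩ :=
        compact_exists_isClopen_in_isOpen isClosed_closure.isOpen_compl hxa
      have hfa : clopenIndicator Vᶜ hV.compl * a = a := by
        ext t
        by_cases ht : t ∈ V
        · have : a t = 0 := by
            by_contra h
            exact hVa ht (subset_closure h)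
          simp [this]
        · rw [ContinuousMap.mul_apply, clopenIndicator_of_mem hV.compl ht, one_mul]
      have hle : e x ≤ clopenIndicator Vᶜ hV.compl x :=
        hmin _ (clopenIndicator_mul_self hV.compl) (by rw [← module_mul_apply, hfa]) x
      rw [clopenIndicator_of_notMem hV.compl (by simpa using hxV)] at hle
      rcases idempotent_apply_eq_zero_or_one he x with h | h
      · exact hx h
      · linarith
  rw [this]
  exact hclopen.isOpen

/-- In a Veksler module, if the images of `x` under a decreasing sequence of clopen
indicators converge and the clopen sets decrease to a set with empty interior, then the limit
is zero. -/
lemma limit_eq_zero_of_interior_iInter_eq_empty [CompleteSpace X]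
    (hVeksler : ∀ z : X, z ≠ 0 → ∃ e : C(K, ℝ), IsCarrier m z e)
    (C : ℕ → Set K) (hC : ∀ n, IsClopen (C n)) (hanti : Antitone C)
    (hint : interior (⋂ n, C n) = ∅) {x z : X}
    (hz : Tendsto (fun n => m (clopenIndicator (C n) (hC n)) x) atTop (𝓝 z)) : z = 0 := by
  by_contra hz0
  obtain ⟨e, he, hez, hmin⟩ := hVeksler z hz0
  have hfix : ∀ n, m (clopenIndicator (C n) (hC n)) z = z := by
    intro n
    refine tendsto_nhds_unique
      (((m (clopenIndicator (C n) (hC n))).continuous.tendsto z).comp hz) (hz.congr' ?_)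
    filter_upwards [eventually_ge_atTop n] with l hl
    rw [Function.comp_apply, ← module_mul_apply, mul_comm,
      clopenIndicator_mul_of_subset _ _ (hanti hl)]
  have hsub : {x | e x ≠ 0} ⊆ ⋂ n, C n := by
    refine Set.subset_iInter fun n t ht => ?_
    by_contra htC
    have hle : e t ≤ clopenIndicator (C n) (hC n) t :=
      hmin _ (clopenIndicator_mul_self (hC n)) (hfix n) t
    rw [clopenIndicator_of_notMem _ htC] at hle
    rcases idempotent_apply_eq_zero_or_one he t with h | h
    · exact ht h
    · linarith
  have hempty : {x | e x ≠ 0} ⊆ ∅ :=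
    hint ▸ interior_maximal hsub (isClopen_support_of_idempotent he).isOpen
  have he0 : e = 0 := by
    ext t
    by_contra h
    exact hempty h
  rw [he0, map_zero, zero_apply] at hez
  exact hz0 hez.symm

/-- Countable subadditivity: the indicator of the closure of a countable union of
clopen sets is controlled by the indicators of the pieces. -/
lemma norm_clopenIndicator_closure_iUnion_le [CompleteSpace X]
    (hm : ∀ a : C(K, ℝ), ‖m a‖ = ‖a‖)
    (hVeksler : ∀ z : X, z ≠ 0 → ∃ e : C(K, ℝ), IsCarrier m z e) {x : X}
    (Q : ℕ → Set K) (hQ : ∀ k, IsClopen (Q k)) (hcl : IsClopen (closure (⋃ k, Q k))) {δ : ℝ}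
    (hδ : ∀ k, ‖m (clopenIndicator (Q k) (hQ k)) x‖ ≤ δ / 2 / 2 ^ k) :
    ‖m (clopenIndicator (closure (⋃ k, Q k)) hcl) x‖ ≤ δ := by
  set P := closure (⋃ k, Q k) with hP
  set C : ℕ → Set K := fun N => P \ ⋃ k ∈ Finset.range N, Q k with hCdef
  have hC : ∀ N, IsClopen (C N) := fun N =>
    hcl.diff ((Finset.range N).finite_toSet.isClopen_biUnion fun k _ => hQ k)
  have hstep : ∀ N, clopenIndicator (C N) (hC N) - clopenIndicator (C (N + 1)) (hC (N + 1)) =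
      clopenIndicator (C N) (hC N) * clopenIndicator (Q N) (hQ N) := by
    intro N
    have hmem : ∀ t, t ∈ C (N + 1) ↔ t ∈ C N ∧ t ∉ Q N := by
      intro t
      simp only [hCdef, Set.mem_sdiff, Set.mem_iUnion, Finset.mem_range, not_exists,
        Nat.lt_succ_iff_lt_or_eq]
      grind
    ext t
    by_cases h1 : t ∈ C N <;> by_cases h2 : t ∈ Q N <;>
      simp [clopenIndicator, hmem, h1, h2]
  have hanti : Antitone C := antitone_nat_of_succ_le fun N => by
    refine Set.sdiff_subset_sdiff_right (Set.biUnion_subset_biUnion_left ?_)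
    intro k hk
    simp only [Finset.coe_range, Set.mem_Iio] at hk ⊢
    omega
  have hdist : ∀ N, dist (m (clopenIndicator (C N) (hC N)) x)
      (m (clopenIndicator (C (N + 1)) (hC (N + 1))) x) ≤ δ / 2 / 2 ^ N := by
    intro N
    rw [dist_eq_norm, ← sub_apply, ← map_sub, hstep, module_mul_apply]
    exact (norm_clopenIndicator_apply_le hm _ _).trans (hδ N)
  obtain ⟨z, hz⟩ := cauchySeq_tendsto_of_complete (cauchySeq_of_le_geometric_two hdist)
  have hint : interior (⋂ N, C N) = ∅ := by
    rw [Set.eq_empty_iff_forall_notMem]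
    intro t ht
    have htP : t ∈ P := (Set.mem_iInter.1 (interior_subset ht) 0).1
    obtain ⟨r, hr1, hr2⟩ := mem_closure_iff.1 htP _ isOpen_interior ht
    obtain ⟨k, hk⟩ := Set.mem_iUnion.1 hr2
    refine (Set.mem_iInter.1 (interior_subset hr1) (k + 1)).2 ?_
    simp only [Set.mem_iUnion, Finset.mem_range]
    exact ⟨k, Nat.lt_succ_self k, hk⟩
  have hz0 := limit_eq_zero_of_interior_iInter_eq_empty hVeksler C hC hanti hint hz
  have hfin := dist_le_of_le_geometric_two_of_tendsto₀ hdist hz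
  have hC0 : clopenIndicator (C 0) (hC 0) = clopenIndicator P hcl := by
    ext t
    simp [clopenIndicator, hCdef]
  rwa [hz0, dist_zero_right, hC0] at hfin

/-- An Egorov-type theorem: every vector of a cyclic Veksler module lies in `m(C(K)) x₀`
off clopen sets whose indicators tend to zero at the cyclic vector. -/
lemma exists_clopen_localization [TotallyDisconnectedSpace K] [CompleteSpace X]
    (hm : ∀ a : C(K, ℝ), ‖m a‖ = ‖a‖) {x₀ : X}
    (hcyc : DenseRange fun a : C(K, ℝ) => m a x₀)
    (hVeksler : ∀ z : X, z ≠ 0 → ∃ e : C(K, ℝ), IsCarrier m z e) (y : X) :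
    ∃ (P : ℕ → Set K) (hP : ∀ n, IsClopen (P n)) (b : ℕ → C(K, ℝ)), Antitone P ∧
      Tendsto (fun n => m (clopenIndicator (P n) (hP n)) x₀) atTop (𝓝 0) ∧
      ∀ n, m (b n) x₀ = m (clopenIndicator (P n)ᶜ (hP n).compl) y := by
  have hBD := isOpen_closure_cozero hm hcyc hVeksler
  have happrox : ∀ k : ℕ, ∃ a : C(K, ℝ), ‖y - m a x₀‖ < (1 / 4 : ℝ) ^ k / 2 := by
    intro k
    obtain ⟨a, ha⟩ := hcyc.exists_dist_lt y (by positivity : (0 : ℝ) < (1 / 4 : ℝ) ^ k / 2)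
    exact ⟨a, by rwa [dist_eq_norm] at ha⟩
  choose a ha using happrox
  have hconv : Tendsto (fun k => m (a k) x₀) atTop (𝓝 y) := by
    rw [tendsto_iff_norm_sub_tendsto_zero]
    have h4 : Tendsto (fun k : ℕ => (1 / 4 : ℝ) ^ k / 2) atTop (𝓝 0) := by
      simpa using (tendsto_pow_atTop_nhds_zero_of_lt_one (r := (1 / 4 : ℝ)) (by norm_num)
        (by norm_num)).div_const 2
    refine squeeze_zero (fun _ => norm_nonneg _) (fun k => ?_) h4
    rw [norm_sub_rev]
    exact (ha k).le
  have hdiff : ∀ k, ‖m (a k - a (k + 1)) x₀‖ ≤ (1 / 4 : ℝ) ^ k := by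
    intro k
    have : m (a k - a (k + 1)) x₀ = (y - m (a (k + 1)) x₀) - (y - m (a k) x₀) := by
      rw [map_sub, sub_apply]; abel
    rw [this]
    refine (norm_sub_le _ _).trans ?_
    have h1 := ha k
    have h2 := ha (k + 1)
    rw [pow_succ] at h2
    have : (0 : ℝ) < (1 / 4 : ℝ) ^ k := by positivity
    linarith
  set g : ℕ → C(K, ℝ) := fun k =>
    ⟨fun t => max (|(a k - a (k + 1)) t| - (1 / 2) ^ k) 0, by fun_prop⟩ with hg
  have hgne : ∀ k t, g k t ≠ 0 ↔ (1 / 2 : ℝ) ^ k < |(a k - a (k + 1)) t| := by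
    intro k t
    rw [← sub_pos, ← not_iff_not, not_not, not_lt]
    exact max_eq_right_iff
  set Q : ℕ → Set K := fun k => closure {t | g k t ≠ 0} with hQdef
  have hQ : ∀ k, IsClopen (Q k) := fun k => ⟨isClosed_closure, hBD _⟩
  have hQge : ∀ k, ∀ t ∈ Q k, (1 / 2 : ℝ) ^ k ≤ |(a k - a (k + 1)) t| := by
    intro k
    refine closure_minimal (fun t ht => ((hgne k t).1 ht).le) ?_
    exact isClosed_le continuous_const (a k - a (k + 1)).continuous.abs
  have hQnorm : ∀ k, ‖m (clopenIndicator (Q k) (hQ k)) x₀‖ ≤ (1 / 2 : ℝ) ^ k := by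
    intro k
    refine (norm_clopenIndicator_apply_le_of_le_abs hm (hQ k) (by positivity) (hQge k) x₀).trans ?_
    refine (mul_le_mul_of_nonneg_left (hdiff k) (by positivity)).trans (le_of_eq ?_)
    rw [← inv_pow, ← mul_pow]
    norm_num
  set P : ℕ → Set K := fun n => closure (⋃ k, Q (n + k)) with hPdef
  have hP : ∀ n, IsClopen (P n) := by
    intro n
    have : P n = closure (⋃ k, {t | g (n + k) t ≠ 0}) := by
      refine Set.Subset.antisymm (closure_minimal (Set.iUnion_subset fun k => ?_)
        isClosed_closure) (closure_mono (Set.iUnion_mono fun k => subset_closure))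
      exact closure_mono (Set.subset_iUnion (fun k => {t | g (n + k) t ≠ 0}) k)
    exact ⟨isClosed_closure, this ▸ isOpen_closure_iUnion_cozero hBD fun k => g (n + k)⟩
  have hPnorm : ∀ n, ‖m (clopenIndicator (P n) (hP n)) x₀‖ ≤ 2 * (1 / 2 : ℝ) ^ n := by
    intro n
    refine norm_clopenIndicator_closure_iUnion_le hm hVeksler (fun k => Q (n + k))
      (fun k => hQ (n + k)) (hP n) fun k => (hQnorm (n + k)).trans (le_of_eq ?_)
    rw [pow_add, one_div, inv_pow, inv_pow]
    field_simp
  have hanti : Antitone P := by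
    intro n l hnl
    refine closure_mono (Set.iUnion_subset fun k => ?_)
    obtain ⟨j, rfl⟩ := Nat.exists_eq_add_of_le hnl
    rw [add_assoc]
    exact Set.subset_iUnion (fun k => Q (n + k)) (j + k)
  have hoff : ∀ n k, n ≤ k → ∀ t ∉ P n, |(a k - a (k + 1)) t| ≤ (1 / 2 : ℝ) ^ k := by
    intro n k hnk t ht
    by_contra! h
    obtain ⟨j, rfl⟩ := Nat.exists_eq_add_of_le hnk
    exact ht (subset_closure (Set.mem_iUnion.2 ⟨j, subset_closure ((hgne _ _).2 h)⟩))
  have hb : ∀ n, ∃ b : C(K, ℝ), m b x₀ = m (clopenIndicator (P n)ᶜ (hP n).compl) y := by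
    intro n
    set d := clopenIndicator (P n)ᶜ (hP n).compl
    have hdist : ∀ k, dist (d * a (n + k)) (d * a (n + (k + 1))) ≤ 2 / 2 / 2 ^ k := by
      intro k
      rw [dist_eq_norm, ← mul_sub, ContinuousMap.norm_le _ (by positivity)]
      intro t
      by_cases ht : t ∈ P n
      · rw [ContinuousMap.mul_apply, clopenIndicator_of_notMem _ (by simpa using ht), zero_mul,
          norm_zero]
        positivity
      · rw [ContinuousMap.mul_apply, clopenIndicator_of_mem _ ht, one_mul, Real.norm_eq_abs]
        refine (hoff n (n + k) (Nat.le_add_right _ _) t ht).trans ?_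
        rw [div_self two_ne_zero, ← one_div_pow]
        exact pow_le_pow_of_le_one (by norm_num) (by norm_num) (Nat.le_add_left _ _)
    obtain ⟨b, hb⟩ := cauchySeq_tendsto_of_complete (cauchySeq_of_le_geometric_two hdist)
    refine ⟨b, ?_⟩
    have hmc : Continuous fun c : C(K, ℝ) => m c x₀ := by
      refine AddMonoidHomClass.continuous_of_bound
        ({ toFun := fun c : C(K, ℝ) => m c x₀
           map_add' := fun c c' => by simp
           map_smul' := fun r c => by simp } : C(K, ℝ) →ₗ[ℝ] X) ‖x₀‖ fun c => ?_
      rw [mul_comm]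
      exact norm_module_apply_le hm c x₀
    refine tendsto_nhds_unique ((hmc.tendsto b).comp hb) ?_
    have hsub : Tendsto (fun k => m (a (n + k)) x₀) atTop (𝓝 y) :=
      hconv.comp (tendsto_atTop_mono (fun k => Nat.le_add_left k n) tendsto_id)
    refine (((m d).continuous.tendsto y).comp hsub).congr fun k => ?_
    simp only [Function.comp_apply, module_mul_apply]
  choose b hb using hb
  refine ⟨P, hP, b, hanti, ?_, hb⟩
  refine squeeze_zero_norm hPnorm ?_
  simpa using (tendsto_pow_atTop_nhds_zero_of_lt_one (r := (1 / 2 : ℝ)) (by norm_num)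
    (by norm_num)).const_mul 2

end CyclicModule

/-- For a cyclic Veksler module, `m(C(K))` is closed in the weak operator topology:
any operator `T` that can be approximated by elements of `m(C(K))` on finitely many
vector/functional pairs lies in the range of `m`. -/
theorem stmt9 {K X : Type*} [TopologicalSpace K] [CompactSpace K] [T2Space K]
    [TotallyDisconnectedSpace K]
    [NormedAddCommGroup X] [NormedSpace ℝ X] [CompleteSpace X]
    (m : C(K, ℝ) →ₐ[ℝ] (X →L[ℝ] X))
    (hm : ∀ a : C(K, ℝ), ‖m a‖ = ‖a‖)
    (x₀ : X) (hcyc : DenseRange fun a : C(K, ℝ) => m a x₀)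
    (hVeksler : ∀ z : X, z ≠ 0 → ∃ e : C(K, ℝ), IsCarrier m z e) :
    ∀ T : X →L[ℝ] X,
      (∀ ε > (0 : ℝ), ∀ s : Finset (X × (X →L[ℝ] ℝ)), ∃ a : C(K, ℝ),
        ∀ p ∈ s, |p.2 (m a p.1) - p.2 (T p.1)| < ε) →
      T ∈ Set.range m := by
  intro T hT
  have hcomm := commute_of_weak_limit hT
  obtain ⟨P, hP, b, hanti, hlim, hb⟩ := exists_clopen_localization hm hcyc hVeksler (T x₀)
  set d : ℕ → C(K, ℝ) := fun n => clopenIndicator (P n)ᶜ (hP n).compl with hd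
  have hTd : ∀ n, T ∘L m (d n) = m (b n) := fun n =>
    eq_module_of_apply_cyclic hcyc
      (fun a x => by
        simp only [ContinuousLinearMap.comp_apply]
        rw [module_comm_apply, hcomm])
      (by rw [ContinuousLinearMap.comp_apply, hcomm, hb])
  have hbM : ∀ n, ‖b n‖ ≤ ‖T‖ := by
    intro n
    rw [← hm, ← hTd]
    refine (T.opNorm_comp_le _).trans ?_
    rw [hm]
    exact mul_le_of_le_one_right (norm_nonneg _) (norm_clopenIndicator_le _)
  have hcompat : ∀ n l, n ≤ l → d n * b l = b n := by
    intro n l hnl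
    refine eq_of_apply_cyclic hm hcyc ?_
    rw [module_mul_apply, hb, hb, ← module_mul_apply,
      clopenIndicator_mul_of_subset _ _ (Set.compl_subset_compl.2 (hanti hnl))]
  have hdense : Dense (⋃ n, (P n)ᶜ) := by
    rw [← Set.compl_iInter, ← interior_eq_empty_iff_dense_compl,
      Set.eq_empty_iff_forall_notMem]
    intro t ht
    obtain ⟨V, hV, htV, hVP⟩ := compact_exists_isClopen_in_isOpen isOpen_interior ht
    have hzero : m (clopenIndicator V hV) x₀ = 0 := by
      have h := ((m (clopenIndicator V hV)).continuous.tendsto 0).comp hlim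
      rw [map_zero] at h
      refine tendsto_nhds_unique (tendsto_const_nhds.congr fun n => ?_) h
      rw [Function.comp_apply, ← module_mul_apply, clopenIndicator_mul_of_subset]
      exact fun r hr => Set.mem_iInter.1 (interior_subset (hVP hr)) n
    have hV0 : clopenIndicator V hV = 0 := eq_of_apply_cyclic hm hcyc (by simp [hzero])
    have h1 := clopenIndicator_of_mem hV htV
    rw [hV0] at h1
    exact zero_ne_one h1
  obtain ⟨f, hf⟩ := exists_extension_of_compatible (isOpen_closure_cozero hm hcyc hVeksler)
    (fun n => (P n)ᶜ) (fun n => (hP n).compl)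
    hdense b ‖T‖ hbM
    (fun n l hnl t ht => by
      rw [← hcompat n l hnl, ContinuousMap.mul_apply, clopenIndicator_of_mem _ ht, one_mul])
  have hdf : ∀ n, d n * f = b n := by
    intro n
    rw [← hcompat n n le_rfl]
    ext t
    by_cases ht : t ∈ (P n)ᶜ
    · rw [ContinuousMap.mul_apply, ContinuousMap.mul_apply, hf n t ht]
    · simp [hd, clopenIndicator_of_notMem _ ht]
  refine ⟨f, (eq_module_of_apply_cyclic hcyc hcomm ?_).symm⟩
  have hp : ∀ n, (T - m f) (m (clopenIndicator (P n) (hP n)) x₀) = T x₀ - m f x₀ := by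
    intro n
    have hx : m (clopenIndicator (P n) (hP n)) x₀ = x₀ - m (d n) x₀ := by
      rw [eq_sub_of_add_eq (clopenIndicator_add_compl (hP n)), map_sub, map_one]
      rfl
    have h0 : T (m (d n) x₀) = m f (m (d n) x₀) := by
      rw [module_comm_apply, ← module_mul_apply, hdf, ← hTd]
      rfl
    rw [hx, map_sub, sub_apply, sub_apply, h0]
    simp
  have h := ((T - m f).continuous.tendsto 0).comp hlim
  rw [map_zero] at h
  exact sub_eq_zero.1 (tendsto_nhds_unique (tendsto_const_nhds.congr fun n => (hp n).symm) h)
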